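/- For every δ > 0 there exists n₀ ∈ ℕ such that for all n > n₀: every even permutation h of Z₂ⁿ can be realized by a reversible circuit with n inputs (no additional inputs) of gates from Ωₙ² whose depth is at most (32 + δ)·n·2ⁿ/log₂ n; in particular the Shannon depth function satisfies D(n,0) ≤ (32 + δ)·n·2ⁿ/log₂ n. -/

import Mathlib

namespace RevCirc

/-- A reversible gate on `n` wires: a target coordinate together with a set of
at most two control coordinates not containing the target.  With no controls it
is a NOT gate, with one control a CNOT gate and with two controls a 2-CNOT
(Toffoli) gate. -/
abbrev Gate (n : ℕ) : Type :=
  {p : Fin n × Finset (Fin n) // p.2.card ≤ 2 ∧ p.1 ∉ p.2}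

def Gate.target {n : ℕ} (g : Gate n) : Fin n := g.1.1

def Gate.controls {n : ℕ} (g : Gate n) : Finset (Fin n) := g.1.2

/-- The transformation of `ℤ₂ⁿ` defined by a gate: the target coordinate is
XOR-ed with the conjunction of the control coordinates. -/
def Gate.apply {n : ℕ} (g : Gate n) (x : Fin n → Bool) : Fin n → Bool :=
  fun i => if i = g.target then xor (x i) (decide (∀ j ∈ g.controls, x j = true)) else x i

/-- The transformation defined by a circuit (a list of gates, applied left to right). -/
def evalCircuit {n : ℕ} (c : List (Gate n)) (x : Fin n → Bool) : Fin n → Bool :=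
  c.foldl (fun y g => g.apply y) x

/-- A circuit realizes a permutation `h` of `ℤ₂ⁿ` (without additional inputs) if the
composition of its gates equals `h`. -/
def realizes {n : ℕ} (c : List (Gate n)) (h : Equiv.Perm (Fin n → Bool)) : Prop :=
  ∀ x, evalCircuit c x = h x

/-- The expanding function `ℤ₂ⁿ → ℤ₂^{n+q}` padding with zeros. -/
def expand (n q : ℕ) (x : Fin n → Bool) : Fin (n + q) → Bool :=
  fun i => if h : (i : ℕ) < n then x ⟨i, h⟩ else false

/-- A circuit with `n+q` inputs implements `f : ℤ₂ⁿ → ℤ₂ⁿ` using `q` additional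
inputs if for some permutation `π` of the wires, the coordinates `π(1),…,π(n)` of the
output on the zero-padded input give `f`. -/
def implements (n q : ℕ) (c : List (Gate (n + q)))
    (f : (Fin n → Bool) → (Fin n → Bool)) : Prop :=
  ∃ π : Equiv.Perm (Fin (n + q)), ∀ x : Fin n → Bool, ∀ i : Fin n,
    evalCircuit c (expand n q x) (π (Fin.castLE (Nat.le_add_right n q) i)) = f x i

/-- `F(n,q)`: the set of transformations `ℤ₂ⁿ → ℤ₂ⁿ` implementable by reversible
circuits with `n+q` inputs. -/
def FSet (n q : ℕ) : Set ((Fin n → Bool) → (Fin n → Bool)) :=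
  {f | ∃ c : List (Gate (n + q)), implements n q c f}

/-- The set of wires touched by a gate: its target together with its controls. -/
def Gate.support {n : ℕ} (g : Gate n) : Finset (Fin n) := insert g.target g.controls

/-- A circuit has depth 1 if the supports of its gates are pairwise disjoint. -/
def DepthOne {n : ℕ} (c : List (Gate n)) : Prop :=
  c.Pairwise fun g₁ g₂ => Disjoint g₁.support g₂.support

/-- The depth of a circuit: the minimal number of consecutive depth-1 sub-circuits
into which it can be divided. -/
noncomputable def depth {n : ℕ} (c : List (Gate n)) : ℕ :=
  sInf {d | ∃ parts : List (List (Gate n)),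
    parts.flatten = c ∧ (∀ p ∈ parts, DepthOne p) ∧ parts.length = d}

/-- The quantum weight of a circuit: each NOT and CNOT gate weighs `WC`, each
2-CNOT gate weighs `WT`. -/
def weight {n : ℕ} (WC WT : ℝ) (c : List (Gate n)) : ℝ :=
  (c.map fun g => if g.controls.card = 2 then WT else WC).sum

/-- `L(f,q)`: minimal gate complexity of a circuit implementing `f` with `q`
additional inputs. -/
noncomputable def Lmin (n q : ℕ) (f : (Fin n → Bool) → (Fin n → Bool)) : ℕ :=
  sInf {l | ∃ c : List (Gate (n + q)), implements n q c f ∧ c.length = l}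

/-- The Shannon gate complexity function `L(n,q)`. -/
noncomputable def ShannonL (n q : ℕ) : ℕ := sSup (Lmin n q '' FSet n q)

/-- `D(f,q)`: minimal depth of a circuit implementing `f` with `q` additional inputs. -/
noncomputable def Dmin (n q : ℕ) (f : (Fin n → Bool) → (Fin n → Bool)) : ℕ :=
  sInf {d | ∃ c : List (Gate (n + q)), implements n q c f ∧ depth c = d}

/-- The Shannon depth function `D(n,q)`. -/
noncomputable def ShannonD (n q : ℕ) : ℕ := sSup (Dmin n q '' FSet n q)

/-- `W(f,q)`: minimal quantum weight of a circuit implementing `f` with `q`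
additional inputs. -/
noncomputable def Wmin (WC WT : ℝ) (n q : ℕ) (f : (Fin n → Bool) → (Fin n → Bool)) : ℝ :=
  sInf {w | ∃ c : List (Gate (n + q)), implements n q c f ∧ weight WC WT c = w}

/-- The Shannon quantum weight function `W(n,q)`. -/
noncomputable def ShannonW (WC WT : ℝ) (n q : ℕ) : ℝ := sSup (Wmin WC WT n q '' FSet n q)

/-- A permutation is a product of `K` pairwise disjoint (independent) transpositions:
there are `2K` pairwise distinct points `x i, y i` with `g = (x 1, y 1)∘⋯∘(x K, y K)`. -/
def IsProdOfDisjointTranspositions {X : Type*} [DecidableEq X] (K : ℕ)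
    (g : Equiv.Perm X) : Prop :=
  ∃ x y : Fin K → X,
    Function.Injective (Sum.elim x y) ∧
    g = ((List.finRange K).map fun i => Equiv.swap (x i) (y i)).prod

end RevCirc


namespace RevCirc

/-- Conjunction of the coordinates in `S`. -/
def al {n : ℕ} (S : Finset (Fin n)) (x : Fin n → Bool) : Bool := decide (∀ j ∈ S, x j = true)

lemma al_iff {n : ℕ} (S : Finset (Fin n)) (x : Fin n → Bool) :
    al S x = true ↔ ∀ j ∈ S, x j = true := by simp [al]

lemma al_empty {n : ℕ} (x : Fin n → Bool) : al ∅ x = true := by simp [al]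

lemma al_congr {n : ℕ} (S : Finset (Fin n)) (x y : Fin n → Bool) (h : ∀ j ∈ S, x j = y j) :
    al S x = al S y := by
  rw [Bool.eq_iff_iff, al_iff, al_iff]
  exact forall₂_congr fun j hj => by rw [h j hj]

lemma al_insert {n : ℕ} (b : Fin n) (S : Finset (Fin n)) (x : Fin n → Bool) :
    al (insert b S) x = (x b && al S x) := by
  rw [Bool.eq_iff_iff, al_iff]
  simp [al_iff]

lemma al_union {n : ℕ} (S T : Finset (Fin n)) (x : Fin n → Bool) :
    al (S ∪ T) x = (al S x && al T x) := by
  rw [Bool.eq_iff_iff, al_iff]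
  simp only [Bool.and_eq_true, al_iff, Finset.mem_union]
  constructor
  · intro h
    exact ⟨fun j hj => h j (Or.inl hj), fun j hj => h j (Or.inr hj)⟩
  · rintro ⟨h1, h2⟩ j (hj | hj)
    exacts [h1 j hj, h2 j hj]

lemma al_update {n : ℕ} (S : Finset (Fin n)) (x : Fin n → Bool) (t : Fin n) (v : Bool)
    (ht : t ∉ S) : al S (Function.update x t v) = al S x := by
  apply al_congr
  intro j hj
  rw [Function.update_of_ne]
  rintro rfl
  exact ht hj

def mfun {n : ℕ} (S : Finset (Fin n)) (t : Fin n) (x : Fin n → Bool) : Fin n → Bool :=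
  Function.update x t (xor (x t) (al (S.erase t) x))

lemma mfun_invol {n : ℕ} (S : Finset (Fin n)) (t : Fin n) :
    Function.Involutive (mfun S t) := by
  intro x
  unfold mfun
  rw [al_update _ _ _ _ (Finset.notMem_erase t S)]
  simp

/-- The multiply controlled NOT. -/
def mcx {n : ℕ} (S : Finset (Fin n)) (t : Fin n) : Equiv.Perm (Fin n → Bool) :=
  (mfun_invol S t).toPerm

lemma mcx_apply {n : ℕ} (S : Finset (Fin n)) (t : Fin n) (ht : t ∉ S) (x : Fin n → Bool) :
    mcx S t x = Function.update x t (xor (x t) (al S x)) := by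
  change mfun S t x = _
  rw [mfun, Finset.erase_eq_of_notMem ht]

lemma mcx_mul_self {n : ℕ} (S : Finset (Fin n)) (t : Fin n) : mcx S t * mcx S t = 1 := by
  ext1 x
  exact mfun_invol S t x

lemma mcx_inv {n : ℕ} (S : Finset (Fin n)) (t : Fin n) : (mcx S t)⁻¹ = mcx S t :=
  inv_eq_of_mul_eq_one_left (mcx_mul_self S t)

lemma mcx_comm_formula {n : ℕ} (S S' : Finset (Fin n)) (b t : Fin n) (htb : t ≠ b)
    (hbS : b ∉ S) (htS : t ∉ S) (hbS' : b ∉ S') (htS' : t ∉ S') :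
    mcx (insert b S) t * mcx S' b * mcx (insert b S) t * mcx S' b = mcx (S ∪ S') t := by
  ext1 x
  have h1 : t ∉ insert b S := by simp [htb, htS]
  have h2 : t ∉ S ∪ S' := by simp [htS, htS']
  simp only [Equiv.Perm.mul_apply, mcx_apply _ _ h1, mcx_apply _ _ h2, mcx_apply _ _ hbS',
    al_insert, al_union]
  funext w
  simp only [al_update _ _ _ _ hbS, al_update _ _ _ _ htS, al_update _ _ _ _ hbS',
    al_update _ _ _ _ htS', Function.update_apply, htb, htb.symm, if_true, if_false]
  by_cases hwt : w = t
  · subst hwt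
    simp only [htb, if_true, if_false]
    cases x w <;> cases x b <;> cases al S x <;> cases al S' x <;> rfl
  · by_cases hwb : w = b
    · subst hwb
      simp only [htb.symm, if_true, if_false]
      cases x w <;> cases al S' x <;> rfl
    · simp [hwt, hwb]

/-- A gate as a permutation. -/
def Gate.perm {n : ℕ} (g : Gate n) : Equiv.Perm (Fin n → Bool) := mcx g.controls g.target

lemma Gate.perm_apply {n : ℕ} (g : Gate n) (x : Fin n → Bool) : g.perm x = g.apply x := by
  unfold Gate.perm Gate.apply
  rw [mcx_apply g.controls g.target g.2.2]
  funext w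
  rw [Function.update_apply]
  split
  · next h => subst h; rfl
  · rfl

/-- Realizability in depth `d` by gates on the wires `U`. -/
inductive Rz {n : ℕ} : Finset (Fin n) → ℕ → Equiv.Perm (Fin n → Bool) → Prop
  | one : Rz ∅ 0 1
  | gate (g : Gate n) : Rz g.support 1 g.perm
  | mono {U V : Finset (Fin n)} {d e : ℕ} {σ : Equiv.Perm (Fin n → Bool)} :
      Rz U d σ → U ⊆ V → d ≤ e → Rz V e σ
  | seq {U : Finset (Fin n)} {d e : ℕ} {σ τ : Equiv.Perm (Fin n → Bool)} :
      Rz U d σ → Rz U e τ → Rz U (d + e) (σ * τ)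
  | par {U V : Finset (Fin n)} {d : ℕ} {σ τ : Equiv.Perm (Fin n → Bool)} :
      Disjoint U V → Rz U d σ → Rz V d τ → Rz (U ∪ V) d (σ * τ)

/-- `f` acts only on the wires of `U`. -/
def Loc {n : ℕ} (U : Finset (Fin n)) (f : (Fin n → Bool) → (Fin n → Bool)) : Prop :=
  (∀ x w, w ∉ U → f x w = x w) ∧
  (∀ x y, (∀ w ∈ U, x w = y w) → ∀ w ∈ U, f x w = f y w)

lemma Loc.mono {n : ℕ} {U V : Finset (Fin n)} {f : (Fin n → Bool) → (Fin n → Bool)}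
    (h : Loc U f) (hUV : U ⊆ V) : Loc V f := by
  refine ⟨fun x w hw => h.1 x w (fun h' => hw (hUV h')), fun x y hxy w hw => ?_⟩
  by_cases hU : w ∈ U
  · exact h.2 x y (fun w hw => hxy w (hUV hw)) w hU
  · rw [h.1 x w hU, h.1 y w hU, hxy w hw]

lemma Loc.comp {n : ℕ} {U : Finset (Fin n)} {f g : (Fin n → Bool) → (Fin n → Bool)}
    (hf : Loc U f) (hg : Loc U g) : Loc U (fun x => f (g x)) :=
  ⟨fun x w hw => (hf.1 _ _ hw).trans (hg.1 _ _ hw),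
    fun x y hxy w hw => hf.2 _ _ (fun w hw => hg.2 _ _ hxy w hw) w hw⟩

lemma Loc.commute {n : ℕ} {U V : Finset (Fin n)} {f g : (Fin n → Bool) → (Fin n → Bool)}
    (hf : Loc U f) (hg : Loc V g) (hd : Disjoint U V) (x : Fin n → Bool) :
    f (g x) = g (f x) := by
  funext w
  by_cases hU : w ∈ U
  · have hV : w ∉ V := Finset.disjoint_left.mp hd hU
    rw [hg.1 _ _ hV]
    exact hf.2 _ _ (fun v hv => hg.1 _ _ (Finset.disjoint_left.mp hd hv)) w hU
  · rw [hf.1 _ _ hU]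
    by_cases hV : w ∈ V
    · exact (hg.2 _ _ (fun v hv => hf.1 _ _ (Finset.disjoint_right.mp hd hv)) w hV).symm
    · rw [hg.1 _ _ hV, hg.1 _ _ hV, hf.1 _ _ hU]

lemma Gate.loc {n : ℕ} (g : Gate n) : Loc g.support g.apply := by
  constructor
  · intro x w hw
    have : w ≠ g.target := by
      rintro rfl
      exact hw (Finset.mem_insert_self _ _)
    simp [Gate.apply, this]
  · intro x y hxy w hw
    have h2 : al g.controls x = al g.controls y :=
      al_congr _ _ _ fun j hj => hxy j (Finset.mem_insert_of_mem hj)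
    unfold al at h2
    simp only [Gate.apply, hxy w hw, h2]

lemma Rz.loc {n : ℕ} {U : Finset (Fin n)} {d : ℕ} {σ : Equiv.Perm (Fin n → Bool)}
    (h : Rz U d σ) : Loc U σ := by
  induction h with
  | one => exact ⟨fun x w _ => rfl, fun x y hxy w hw => hxy w hw⟩
  | gate g =>
    have : (g.perm : (Fin n → Bool) → (Fin n → Bool)) = g.apply := funext g.perm_apply
    rw [this]
    exact g.loc
  | mono _ hUV _ ih => exact ih.mono hUV
  | seq _ _ ih1 ih2 => exact ih1.comp ih2
  | par _ _ _ ih1 ih2 =>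
    exact (ih1.mono Finset.subset_union_left).comp (ih2.mono Finset.subset_union_right)

lemma Rz.commute {n : ℕ} {U V : Finset (Fin n)} {d e : ℕ} {σ τ : Equiv.Perm (Fin n → Bool)}
    (h : Rz U d σ) (h' : Rz V e τ) (hd : Disjoint U V) : σ * τ = τ * σ := by
  ext1 x
  exact h.loc.commute h'.loc hd x

lemma Rz.inv {n : ℕ} {U : Finset (Fin n)} {d : ℕ} {σ : Equiv.Perm (Fin n → Bool)}
    (h : Rz U d σ) : Rz U d σ⁻¹ := by
  induction h with
  | one => rw [inv_one]; exact Rz.one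
  | gate g =>
    unfold Gate.perm
    rw [mcx_inv]
    exact Rz.gate g
  | mono _ hUV hde ih => exact ih.mono hUV hde
  | seq _ _ ih1 ih2 =>
    rw [mul_inv_rev, add_comm]
    exact ih2.seq ih1
  | par hd _ _ ih1 ih2 =>
    rw [mul_inv_rev, Finset.union_comm]
    exact Rz.par hd.symm ih2 ih1

lemma Rz.update {n : ℕ} {U : Finset (Fin n)} {d : ℕ} {σ : Equiv.Perm (Fin n → Bool)}
    (h : Rz U d σ) (x : Fin n → Bool) (t : Fin n) (v : Bool) (ht : t ∉ U) :
    σ (Function.update x t v) = Function.update (σ x) t v := by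
  funext w
  by_cases hU : w ∈ U
  · have hwt : w ≠ t := by rintro rfl; exact ht hU
    rw [Function.update_of_ne hwt]
    apply h.loc.2 _ _ _ _ hU
    intro u hu
    have hut : u ≠ t := by rintro rfl; exact ht hu
    rw [Function.update_of_ne hut]
  · rw [h.loc.1 _ _ hU]
    simp only [Function.update_apply]
    rw [h.loc.1 _ _ hU]

/-! Interpretation as circuits -/

lemma eval_append {n : ℕ} (c c' : List (Gate n)) (x : Fin n → Bool) :
    evalCircuit (c ++ c') x = evalCircuit c' (evalCircuit c x) := by
  simp [evalCircuit, List.foldl_append]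

lemma eval_loc {n : ℕ} (U : Finset (Fin n)) (c : List (Gate n))
    (hc : ∀ g ∈ c, g.support ⊆ U) : Loc U (evalCircuit c) := by
  induction c with
  | nil => exact ⟨fun x w _ => rfl, fun x y hxy w hw => hxy w hw⟩
  | cons g c ih =>
    have h1 := ih (fun g' hg' => hc g' (List.mem_cons_of_mem _ hg'))
    have h2 := g.loc.mono (hc g List.mem_cons_self)
    exact h1.comp h2

lemma zip_parts {n : ℕ} (U V : Finset (Fin n)) (hd : Disjoint U V) (P : List (List (Gate n))) :
    ∀ Q : List (List (Gate n)), P.length = Q.length →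
    (∀ p ∈ P, DepthOne p) → (∀ p ∈ Q, DepthOne p) →
    (∀ p ∈ P, ∀ g ∈ p, g.support ⊆ U) → (∀ p ∈ Q, ∀ g ∈ p, g.support ⊆ V) →
    ∃ R : List (List (Gate n)), R.length = P.length ∧ (∀ p ∈ R, DepthOne p) ∧
      (∀ p ∈ R, ∀ g ∈ p, g.support ⊆ U ∪ V) ∧
      ∀ x, evalCircuit R.flatten x = evalCircuit P.flatten (evalCircuit Q.flatten x) := by
  induction P with
  | nil =>
    intro Q hl _ _ _ _
    have : Q = [] := List.length_eq_zero_iff.mp hl.symm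
    subst this
    exact ⟨[], rfl, by simp, by simp, fun x => rfl⟩
  | cons p P ih =>
    intro Q hl hP hQ hPU hQV
    cases Q with
    | nil => simp at hl
    | cons q Q =>
      obtain ⟨R, hR1, hR2, hR3, hR4⟩ := ih Q (by simpa using hl)
        (fun r hr => hP r (List.mem_cons_of_mem _ hr)) (fun r hr => hQ r (List.mem_cons_of_mem _ hr))
        (fun r hr => hPU r (List.mem_cons_of_mem _ hr))
        (fun r hr => hQV r (List.mem_cons_of_mem _ hr))
      refine ⟨(p ++ q) :: R, by simp [hR1], ?_, ?_, ?_⟩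
      · intro r hr
        rcases List.mem_cons.mp hr with rfl | hr
        · refine List.pairwise_append.mpr ⟨hP p List.mem_cons_self, hQ q List.mem_cons_self, ?_⟩
          intro a ha b hb
          exact Finset.disjoint_of_subset_left (hPU p List.mem_cons_self a ha)
            (Finset.disjoint_of_subset_right (hQV q List.mem_cons_self b hb) hd)
        · exact hR2 r hr
      · intro r hr
        rcases List.mem_cons.mp hr with rfl | hr
        · intro g hg
          rcases List.mem_append.mp hg with hg | hg
          · exact (hPU p List.mem_cons_self g hg).trans Finset.subset_union_left
          · exact (hQV q List.mem_cons_self g hg).trans Finset.subset_union_right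
        · exact hR3 r hr
      · intro x
        simp only [List.flatten_cons, eval_append, hR4]
        have hp : Loc U (evalCircuit p) := eval_loc U p (hPU p List.mem_cons_self)
        have hq : Loc V (evalCircuit q) := eval_loc V q (hQV q List.mem_cons_self)
        have hQf : Loc V (evalCircuit Q.flatten) := by
          apply eval_loc
          intro g hg
          obtain ⟨r, hr, hgr⟩ := List.mem_flatten.mp hg
          exact hQV r (List.mem_cons_of_mem _ hr) g hgr
        rw [hp.commute hQf hd, hp.commute hq hd]

lemma Rz.parts {n : ℕ} {U : Finset (Fin n)} {d : ℕ} {σ : Equiv.Perm (Fin n → Bool)}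
    (h : Rz U d σ) : ∃ P : List (List (Gate n)), P.length = d ∧ (∀ p ∈ P, DepthOne p) ∧
      (∀ p ∈ P, ∀ g ∈ p, g.support ⊆ U) ∧ ∀ x, evalCircuit P.flatten x = σ x := by
  induction h with
  | one => exact ⟨[], rfl, by simp, by simp, fun x => rfl⟩
  | gate g =>
    refine ⟨[[g]], rfl, ?_, ?_, ?_⟩
    · intro p hp
      rw [List.mem_singleton] at hp
      subst hp
      exact List.pairwise_singleton _ _
    · intro p hp g' hg'
      rw [List.mem_singleton] at hp
      subst hp
      rw [List.mem_singleton] at hg'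
      subst hg'
      exact subset_rfl
    · intro x
      rw [g.perm_apply]
      rfl
  | @mono U V d e σ _ hUV hde ih =>
    obtain ⟨P, h1, h2, h3, h4⟩ := ih
    refine ⟨P ++ List.replicate (e - d) [], by simp [h1]; omega, ?_, ?_, ?_⟩
    · intro p hp
      rcases List.mem_append.mp hp with hp | hp
      · exact h2 p hp
      · rw [(List.mem_replicate.mp hp).2]
        exact List.Pairwise.nil
    · intro p hp
      rcases List.mem_append.mp hp with hp | hp
      · exact fun g hg => (h3 p hp g hg).trans hUV
      · rw [(List.mem_replicate.mp hp).2]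
        simp
    · intro x
      rw [List.flatten_append, eval_append, h4]
      simp [evalCircuit]
  | seq _ _ ih1 ih2 =>
    obtain ⟨P, h1, h2, h3, h4⟩ := ih1
    obtain ⟨Q, k1, k2, k3, k4⟩ := ih2
    refine ⟨Q ++ P, by simp [h1, k1, add_comm], ?_, ?_, ?_⟩
    · intro p hp
      rcases List.mem_append.mp hp with hp | hp
      exacts [k2 p hp, h2 p hp]
    · intro p hp
      rcases List.mem_append.mp hp with hp | hp
      exacts [k3 p hp, h3 p hp]
    · intro x
      rw [List.flatten_append, eval_append, h4, k4]
      rfl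
  | par hd _ _ ih1 ih2 =>
    obtain ⟨P, h1, h2, h3, h4⟩ := ih1
    obtain ⟨Q, k1, k2, k3, k4⟩ := ih2
    obtain ⟨R, r1, r2, r3, r4⟩ := zip_parts _ _ hd P Q (h1.trans k1.symm) h2 k2 h3 k3
    refine ⟨R, r1.trans h1, r2, r3, ?_⟩
    intro x
    rw [r4, h4, k4]
    rfl

lemma Rz.circuit {n : ℕ} {U : Finset (Fin n)} {d : ℕ} {σ : Equiv.Perm (Fin n → Bool)}
    (h : Rz U d σ) : ∃ c : List (Gate n), realizes c σ ∧ depth c ≤ d := by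
  obtain ⟨P, h1, h2, _, h4⟩ := h.parts
  exact ⟨P.flatten, h4, Nat.sInf_le ⟨P, rfl, h2, h1⟩⟩

end RevCirc
namespace RevCirc

lemma rz_mcx {n : ℕ} (S : Finset (Fin n)) (t : Fin n) (h2 : S.card ≤ 2) (ht : t ∉ S) :
    Rz (insert t S) 1 (mcx S t) :=
  Rz.gate ⟨(t, S), h2, ht⟩

lemma Rz.one' {n : ℕ} (U : Finset (Fin n)) (d : ℕ) : Rz U d 1 :=
  Rz.one.mono (Finset.empty_subset _) (Nat.zero_le _)

lemma mcx_comm_formula' {n : ℕ} (S S' : Finset (Fin n)) (b t : Fin n) (htb : t ≠ b)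
    (hbS : b ∉ S) (htS : t ∉ S) (hbS' : b ∉ S') (htS' : t ∉ S') :
    mcx (insert b S) t * mcx S' b * mcx (insert b S) t = mcx (S ∪ S') t * mcx S' b := by
  rw [← mcx_comm_formula S S' b t htb hbS htS hbS' htS']
  rw [mul_assoc _ (mcx S' b) (mcx S' b), mcx_mul_self, mul_one]

lemma ladder_aux {n : ℕ} (k : ℕ) : ∀ (S D : Finset (Fin n)) (t : Fin n), S.card = k + 1 →
    k ≤ D.card → Disjoint S D → t ∉ S → t ∉ D →
    ∃ τ, Rz (S ∪ D) (2 * k + 1) τ ∧ Rz (insert t (S ∪ D)) (2 * k + 1) (mcx S t * τ) := by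
  induction k with
  | zero =>
    intro S D t hS _ _ htS _
    refine ⟨1, Rz.one' _ _, ?_⟩
    rw [mul_one]
    exact (rz_mcx S t (by omega) htS).mono
      (Finset.insert_subset_insert _ Finset.subset_union_left) (by omega)
  | succ k ih =>
    intro S D t hS hD hSD htS htD
    obtain ⟨c, hc⟩ : S.Nonempty := Finset.card_pos.mp (by omega)
    obtain ⟨d, hd⟩ : D.Nonempty := Finset.card_pos.mp (by omega)
    have hcd : c ≠ d := by
      rintro rfl
      exact Finset.disjoint_left.mp hSD hc hd
    have htc : t ≠ c := by rintro rfl; exact htS hc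
    have htd : t ≠ d := by rintro rfl; exact htD hd
    have hdS : d ∉ S := Finset.disjoint_right.mp hSD hd
    have hcD : c ∉ D := Finset.disjoint_left.mp hSD hc
    obtain ⟨τ, h1, h2⟩ := ih (S.erase c) (D.erase d) d
      (by rw [Finset.card_erase_of_mem hc]; omega)
      (by rw [Finset.card_erase_of_mem hd]; omega)
      (Finset.disjoint_of_subset_left (Finset.erase_subset _ _)
        (Finset.disjoint_of_subset_right (Finset.erase_subset _ _) hSD))
      (fun h => hdS (Finset.mem_of_mem_erase h)) (Finset.notMem_erase _ _)
    have hsub : insert d (S.erase c ∪ D.erase d) ⊆ S ∪ D := by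
      intro w hw
      simp only [Finset.mem_insert, Finset.mem_union, Finset.mem_erase] at hw ⊢
      rcases hw with rfl | ⟨_, h⟩ | ⟨_, h⟩
      exacts [Or.inr hd, Or.inl h, Or.inr h]
    refine ⟨mcx (S.erase c) d * τ, h2.mono hsub (by omega), ?_⟩
    have htdc : t ∉ insert d ({c} : Finset (Fin n)) := by simp [htc, htd]
    have hG := rz_mcx (insert d ({c} : Finset (Fin n))) t
      ((Finset.card_insert_le _ _).trans (by simp)) htdc
    have hcomm := hG.commute h1 (by
      rw [Finset.disjoint_left]
      intro w hw
      simp only [Finset.mem_insert, Finset.mem_singleton, Finset.mem_union,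
        Finset.mem_erase, not_or, not_and] at hw ⊢
      rcases hw with rfl | rfl | rfl
      · exact ⟨fun _ => htS, fun _ => htD⟩
      · exact ⟨fun _ => hdS, fun h => absurd rfl h⟩
      · exact ⟨fun h => absurd rfl h, fun _ => hcD⟩)
    have hform := mcx_comm_formula' {c} (S.erase c) d t htd (by simpa using hcd.symm)
      (by simpa using htc) (fun h => hdS (Finset.mem_of_mem_erase h))
      (fun h => htS (Finset.mem_of_mem_erase h))
    have hun : ({c} : Finset (Fin n)) ∪ S.erase c = S := by
      rw [← Finset.insert_eq, Finset.insert_erase hc]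
    rw [hun] at hform
    have hG' : Rz (insert t (S ∪ D)) 1 (mcx (insert d ({c} : Finset (Fin n))) t) := by
      refine hG.mono ?_ le_rfl
      intro w hw
      simp only [Finset.mem_insert, Finset.mem_singleton, Finset.mem_union] at hw ⊢
      rcases hw with rfl | rfl | rfl
      exacts [Or.inl rfl, Or.inr (Or.inr hd), Or.inr (Or.inl hc)]
    have h2' := h2.mono (hsub.trans (Finset.subset_insert t _)) le_rfl
    have := (hG'.seq h2').seq hG'
    rw [mul_assoc, mul_assoc, ← hcomm, ← mul_assoc, ← mul_assoc, hform, mul_assoc] at this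
    exact this.mono subset_rfl (by omega)

lemma ladder {n : ℕ} (S D : Finset (Fin n)) (t : Fin n) (hD : S.card ≤ D.card)
    (hSD : Disjoint S D) (htS : t ∉ S) (htD : t ∉ D) :
    Rz (insert t (S ∪ D)) (4 * S.card + 1) (mcx S t) := by
  rcases Nat.eq_zero_or_pos S.card with h0 | h0
  · exact (rz_mcx S t (by omega) htS).mono
      (Finset.insert_subset_insert _ Finset.subset_union_left) (by omega)
  · obtain ⟨τ, h1, h2⟩ := ladder_aux (S.card - 1) S D t (by omega) (by omega) hSD htS htD
    have := h2.seq (h1.inv.mono (Finset.subset_insert t _) le_rfl)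
    rw [mul_assoc, mul_inv_cancel, mul_one] at this
    exact this.mono subset_rfl (by omega)

lemma cell {n : ℕ} (s : ℕ) (U : Finset (Fin n)) (hU : U.card = 2 * s + 2) :
    ∃ A ⊆ U, A.card = 2 ∧ ∃ W, Rz U (8 * s + 4) W ∧ ∀ x : Fin n → Bool, (∀ a ∈ A, x a = true) →
      ((∀ a ∈ A, W x a = true) ↔ ∀ b ∈ U \ A, x b = true) := by
  obtain ⟨A, hAU, hA⟩ := Finset.exists_subset_card_eq (s := U) (n := 2) (by omega)
  have hUA : (U \ A).card = 2 * s := by rw [Finset.card_sdiff_of_subset hAU]; omega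
  obtain ⟨B, hBU, hB⟩ := Finset.exists_subset_card_eq (s := U \ A) (n := s) (by omega)
  have hC : ((U \ A) \ B).card = s := by rw [Finset.card_sdiff_of_subset hBU]; omega
  have hBC : B ∪ ((U \ A) \ B) = U \ A := Finset.union_sdiff_of_subset hBU
  have hdis : Disjoint B ((U \ A) \ B) := Finset.disjoint_sdiff
  set C := (U \ A) \ B with hCdef
  obtain ⟨a, b, hab, rfl⟩ := Finset.card_eq_two.mp hA
  have haU : a ∈ U := hAU (by simp)
  have hbU : b ∈ U := hAU (by simp)
  have hmem : ∀ w, w ∈ B ∪ C → w ∈ U ∧ w ≠ a ∧ w ≠ b := by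
    intro w hw
    rw [hBC] at hw
    simpa using hw
  have haB : a ∉ B := fun h => (hmem a (Finset.mem_union_left _ h)).2.1 rfl
  have haC : a ∉ C := fun h => (hmem a (Finset.mem_union_right _ h)).2.1 rfl
  have hbB : b ∉ B := fun h => (hmem b (Finset.mem_union_left _ h)).2.2 rfl
  have hbC : b ∉ C := fun h => (hmem b (Finset.mem_union_right _ h)).2.2 rfl
  have hsub : B ∪ C ⊆ U := fun w hw => (hmem w hw).1
  have r1 : Rz U (4 * s + 1) (mcx B a) := by
    have := ladder B C a (by omega) hdis haB haC
    rw [hB] at this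
    exact this.mono (Finset.insert_subset haU hsub) le_rfl
  have r2 : Rz U (4 * s + 1) (mcx C b) := by
    have := ladder C B b (by omega) hdis.symm hbC hbB
    rw [hC, Finset.union_comm] at this
    exact this.mono (Finset.insert_subset hbU hsub) le_rfl
  have r3 : Rz U 1 (mcx ∅ a) := (rz_mcx ∅ a (by simp) (by simp)).mono (by simpa using haU) le_rfl
  have r4 : Rz U 1 (mcx ∅ b) := (rz_mcx ∅ b (by simp) (by simp)).mono (by simpa using hbU) le_rfl
  refine ⟨{a, b}, hAU, hA, mcx B a * mcx C b * mcx ∅ a * mcx ∅ b,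
    (((r1.seq r2).seq r3).seq r4).mono subset_rfl (by omega), ?_⟩
  intro x hx
  have hxa : x a = true := hx a (by simp)
  have hxb : x b = true := hx b (by simp)
  simp only [Equiv.Perm.mul_apply, mcx_apply _ _ haB, mcx_apply _ _ hbC,
    mcx_apply _ _ (Finset.notMem_empty _), al_empty, al_update _ _ _ _ haB,
    al_update _ _ _ _ hbB, al_update _ _ _ _ haC, al_update _ _ _ _ hbC]
  simp only [Finset.mem_insert, Finset.mem_singleton, forall_eq_or_imp, forall_eq,
    Function.update_apply, hab, hab.symm, if_true, if_false, hxa, hxb]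
  rw [← hBC]
  have := al_union B C x
  rw [← al_iff, this]
  simp

lemma cells {n : ℕ} (s m : ℕ) : ∀ (U : Finset (Fin n)), U.card = m * (2 * s + 2) →
    ∃ A ⊆ U, A.card = 2 * m ∧ ∃ W, Rz U (8 * s + 4) W ∧
      ∀ x : Fin n → Bool, (∀ a ∈ A, x a = true) →
      ((∀ a ∈ A, W x a = true) ↔ ∀ b ∈ U \ A, x b = true) := by
  induction m with
  | zero =>
    intro U hU
    have : U = ∅ := by simpa using hU
    subst this
    exact ⟨∅, subset_rfl, by simp, 1, Rz.one' _ _, by simp⟩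
  | succ m ih =>
    intro U hU
    obtain ⟨V, hVU, hV⟩ := Finset.exists_subset_card_eq (s := U) (n := 2 * s + 2)
      (by rw [hU]; nlinarith)
    have hV' : (U \ V).card = m * (2 * s + 2) := by
      rw [Finset.card_sdiff_of_subset hVU, hU, hV, Nat.succ_mul]; omega
    obtain ⟨A1, hA1, hc1, W1, hW1, hs1⟩ := cell s V hV
    obtain ⟨A2, hA2, hc2, W2, hW2, hs2⟩ := ih (U \ V) hV'
    have hd : Disjoint V (U \ V) := Finset.disjoint_sdiff
    have hU' : V ∪ (U \ V) = U := Finset.union_sdiff_of_subset hVU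
    refine ⟨A1 ∪ A2, ?_, ?_, W1 * W2, ?_, ?_⟩
    · exact Finset.union_subset (hA1.trans hVU) (hA2.trans Finset.sdiff_subset)
    · rw [Finset.card_union_of_disjoint, hc1, hc2]
      · ring
      · exact Finset.disjoint_of_subset_left hA1 (Finset.disjoint_of_subset_right hA2 hd)
    · rw [← hU']
      exact Rz.par hd hW1 hW2
    · intro x hx
      have e1 : ∀ a ∈ A1, (W1 * W2) x a = W1 x a := by
        intro a ha
        rw [Equiv.Perm.mul_apply]
        apply hW1.loc.2 _ _ _ _ (hA1 ha)
        intro w hw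
        exact hW2.loc.1 _ _ (Finset.disjoint_left.mp hd hw)
      have e2 : ∀ a ∈ A2, (W1 * W2) x a = W2 x a := by
        intro a ha
        rw [Equiv.Perm.mul_apply]
        exact hW1.loc.1 _ _ (Finset.disjoint_right.mp hd (hA2 ha))
      have k1 := hs1 x (fun a ha => hx a (Finset.mem_union_left _ ha))
      have k2 := hs2 x (fun a ha => hx a (Finset.mem_union_right _ ha))
      have : (∀ a ∈ A1 ∪ A2, (W1 * W2) x a = true) ↔
          (∀ a ∈ A1, W1 x a = true) ∧ (∀ a ∈ A2, W2 x a = true) := by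
        constructor
        · intro h
          exact ⟨fun a ha => (e1 a ha) ▸ h a (Finset.mem_union_left _ ha),
            fun a ha => (e2 a ha) ▸ h a (Finset.mem_union_right _ ha)⟩
        · rintro ⟨h1, h2⟩ a ha
          rcases Finset.mem_union.mp ha with ha | ha
          · rw [e1 a ha]; exact h1 a ha
          · rw [e2 a ha]; exact h2 a ha
      rw [this, k1, k2]
      constructor
      · rintro ⟨h1, h2⟩ b hb
        simp only [Finset.mem_sdiff, Finset.mem_union, not_or] at hb h1 h2
        by_cases hbV : b ∈ V
        · exact h1 b ⟨hbV, hb.2.1⟩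
        · exact h2 b ⟨⟨hb.1, hbV⟩, hb.2.2⟩
      · intro h
        refine ⟨fun b hb => h b ?_, fun b hb => h b ?_⟩
        · simp only [Finset.mem_sdiff, Finset.mem_union, not_or] at hb ⊢
          refine ⟨hVU hb.1, hb.2, fun h' => ?_⟩
          exact Finset.disjoint_left.mp hd hb.1 (hA2 h')
        · simp only [Finset.mem_sdiff, Finset.mem_union, not_or] at hb ⊢
          exact ⟨hb.1.1, fun h' => hb.1.2 (hA1 h'), hb.2⟩

/-- Sublinear depth multiply controlled NOT with one dirty wire `g`. -/
lemma mcx_sqrt {n : ℕ} (s m : ℕ) (hs : 3 ≤ s) (hm : 3 ≤ m) (S : Finset (Fin n)) (t g : Fin n)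
    (h1 : m * (2 * s + 2) ≤ S.card) (h2 : S.card ≤ (m + 1) * (2 * s + 2)) (htS : t ∉ S)
    (hgS : g ∉ S) (htg : t ≠ g) :
    Rz Finset.univ (32 * m + 48 * s + 50) (mcx S t) := by
  obtain ⟨U, hUS, hU⟩ := Finset.exists_subset_card_eq h1
  obtain ⟨A, hAU, hA, W, hW, hsem⟩ := cells s m U hU
  have htU : t ∉ U := fun h => htS (hUS h)
  have hgU : g ∉ U := fun h => hgS (hUS h)
  have htA : t ∉ A := fun h => htU (hAU h)
  have hgA : g ∉ A := fun h => hgU (hAU h)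
  have hR : (S \ U).card ≤ 2 * s + 2 := by
    rw [Finset.card_sdiff_of_subset hUS, hU]
    have : (m + 1) * (2 * s + 2) = m * (2 * s + 2) + (2 * s + 2) := by ring
    omega
  set R := S \ U with hRdef
  have htR : t ∉ R := fun h => htS (Finset.mem_sdiff.mp h).1
  have hgR : g ∉ R := fun h => hgS (Finset.mem_sdiff.mp h).1
  have hD : (U \ A).card = 2 * m * s := by
    rw [Finset.card_sdiff_of_subset hAU, hU, hA]
    have : m * (2 * s + 2) = 2 * m * s + 2 * m := by ring
    omega
  have hARc : (A ∪ R).card ≤ 2 * m + 2 * s + 2 :=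
    (Finset.card_union_le _ _).trans (by omega)
  have hms : 2 * m + 2 * s + 2 ≤ 2 * m * s := by nlinarith
  have r1 : Rz Finset.univ (4 * (2 * m + 2 * s + 2) + 1) (mcx (A ∪ R) g) := by
    refine (ladder (A ∪ R) (U \ A) g (by omega) ?_ ?_ ?_).mono (Finset.subset_univ _) (by omega)
    · rw [Finset.disjoint_left]
      intro w hw hw'
      rw [Finset.mem_sdiff] at hw'
      rcases Finset.mem_union.mp hw with h | h
      · exact hw'.2 h
      · exact (Finset.mem_sdiff.mp h).2 hw'.1
    · simp [hgA, hgR]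
    · simp [hgU]
  have hgAt : t ∉ insert g A := by simp [htg, htA]
  have r2 : Rz Finset.univ (4 * (2 * m + 1) + 1) (mcx (insert g A) t) := by
    have hc : (insert g A).card ≤ 2 * m + 1 := (Finset.card_insert_le _ _).trans (by omega)
    refine (ladder (insert g A) (U \ A) t (by omega) ?_ hgAt ?_).mono
      (Finset.subset_univ _) (by omega)
    · rw [Finset.disjoint_left]
      intro w hw hw'
      rw [Finset.mem_sdiff] at hw'
      rcases Finset.mem_insert.mp hw with rfl | h
      · exact hgU hw'.1
      · exact hw'.2 h
    · simp [htU]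
  have rW : Rz Finset.univ (8 * s + 4) W := hW.mono (Finset.subset_univ _) le_rfl
  have rV := (rW.inv.seq r2).seq rW
  have hV : ∀ x, (W⁻¹ * mcx (insert g A) t * W) x =
      Function.update x t (xor (x t) (x g && al A (W x))) := by
    intro x
    simp only [Equiv.Perm.mul_apply]
    rw [mcx_apply _ _ hgAt, hW.inv.update _ _ _ htU, al_insert, hW.loc.1 _ _ htU,
      hW.loc.1 _ _ hgU]
    simp
  have key : mcx (A ∪ R) g * (W⁻¹ * mcx (insert g A) t * W) *
      mcx (A ∪ R) g * (W⁻¹ * mcx (insert g A) t * W) = mcx S t := by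
    have hgAR : g ∉ A ∪ R := by simp [hgA, hgR]
    have htAR : t ∉ A ∪ R := by simp [htA, htR]
    ext1 x
    have hal : al S x = (al (A ∪ R) x && al A (W x)) := by
      rw [Bool.eq_iff_iff, Bool.and_eq_true, al_iff, al_iff, al_iff]
      constructor
      · intro h
        have hA' : ∀ a ∈ A, x a = true := fun a ha => h a (hUS (hAU ha))
        refine ⟨fun j hj => ?_, (hsem x hA').mpr fun b hb =>
          h b (hUS (Finset.mem_sdiff.mp hb).1)⟩
        rcases Finset.mem_union.mp hj with hj | hj
        · exact hA' j hj
        · exact h j (Finset.mem_sdiff.mp hj).1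
      · rintro ⟨k1, k2⟩ j hj
        have hA' : ∀ a ∈ A, x a = true := fun a ha => k1 a (Finset.mem_union_left _ ha)
        by_cases hjA : j ∈ A
        · exact hA' j hjA
        · by_cases hjU : j ∈ U
          · exact (hsem x hA').mp k2 j (Finset.mem_sdiff.mpr ⟨hjU, hjA⟩)
          · exact k1 j (Finset.mem_union_right _ (Finset.mem_sdiff.mpr ⟨hj, hjU⟩))
    rw [mcx_apply _ _ htS, hal]
    rw [Equiv.Perm.mul_apply, Equiv.Perm.mul_apply, Equiv.Perm.mul_apply]
    rw [hV x, mcx_apply _ _ hgAR, hV, mcx_apply _ _ hgAR]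
    simp only [hW.update _ _ _ htU, hW.update _ _ _ hgU, al_update _ _ _ _ htA,
      al_update _ _ _ _ hgA, al_update _ _ _ _ hgAR, al_update _ _ _ _ htAR]
    funext w
    simp only [Function.update_apply, htg, htg.symm, if_true, if_false]
    by_cases hwt : w = t
    · subst hwt
      simp only [htg, if_true, if_false]
      cases x w <;> cases x g <;> cases al (A ∪ R) x <;> cases al A (W x) <;> rfl
    · by_cases hwg : w = g
      · subst hwg
        simp only [htg.symm, if_true, if_false]
        cases x w <;> cases al (A ∪ R) x <;> rfl
      · simp [hwt, hwg]
  rw [← key]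
  exact (((r1.seq rV).seq r1).seq rV).mono subset_rfl (by omega)

end RevCirc
namespace RevCirc

lemma mask {n : ℕ} (T : Finset (Fin n)) : ∃ σ : Equiv.Perm (Fin n → Bool), Rz T 1 σ ∧
    ∀ x w, σ x w = if w ∈ T then !x w else x w := by
  induction T using Finset.induction_on with
  | empty => exact ⟨1, Rz.one' _ _, by simp⟩
  | insert t T ht ih =>
    obtain ⟨σ, h1, h2⟩ := ih
    have hg := rz_mcx (∅ : Finset (Fin n)) t (by simp) (by simp)
    refine ⟨mcx ∅ t * σ, ?_, ?_⟩
    · have := Rz.par (by simpa using ht) hg h1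
      exact this.mono (by rw [Finset.insert_eq, Finset.insert_eq, Finset.union_empty]) le_rfl
    · intro x w
      rw [Equiv.Perm.mul_apply, mcx_apply _ _ (Finset.notMem_empty _), al_empty,
        Function.update_apply]
      by_cases hw : w = t
      · subst hw
        simp [h2, ht]
      · simp [h2, hw]

lemma pairLayer {n : ℕ} (e : Fin n → Fin n) (T : Finset (Fin n)) :
    Set.InjOn e T → (∀ w ∈ T, e w ∉ T) →
    ∃ σ : Equiv.Perm (Fin n → Bool), Rz (T ∪ T.image e) 1 σ ∧
    ∀ x w, σ x w = if w ∈ T then xor (x w) (x (e w)) else x w := by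
  induction T using Finset.induction_on with
  | empty => exact fun _ _ => ⟨1, Rz.one' _ _, by simp⟩
  | insert t T ht ih =>
    intro hinj hmap
    obtain ⟨σ, h1, h2⟩ := ih (hinj.mono (by simp))
      (fun w hw h => hmap w (Finset.mem_insert_of_mem hw) (Finset.mem_insert_of_mem h))
    have het := hmap t (Finset.mem_insert_self _ _)
    rw [Finset.mem_insert, not_or] at het
    have htt : t ∉ ({e t} : Finset (Fin n)) := by simpa using Ne.symm het.1
    have hg := rz_mcx ({e t} : Finset (Fin n)) t (by simp) htt
    refine ⟨mcx {e t} t * σ, ?_, ?_⟩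
    · refine (Rz.par ?_ hg h1).mono ?_ le_rfl
      · rw [Finset.disjoint_left]
        intro w hw hw'
        simp only [Finset.mem_insert, Finset.mem_singleton] at hw
        rw [Finset.mem_union, Finset.mem_image] at hw'
        rcases hw with rfl | rfl
        · rcases hw' with h | ⟨v, hv, hvw⟩
          · exact ht h
          · exact hmap v (Finset.mem_insert_of_mem hv) (by simp [hvw])
        · rcases hw' with h | ⟨v, hv, hvw⟩
          · exact het.2 h
          · have := hinj (by simp [hv]) (by simp) hvw
            subst this
            exact ht hv
      · intro w hw
        simp only [Finset.mem_union, Finset.mem_insert, Finset.mem_singleton,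
          Finset.mem_image] at hw ⊢
        rcases hw with (rfl | rfl) | h | ⟨v, hv, rfl⟩
        · exact Or.inl (Or.inl rfl)
        · exact Or.inr ⟨t, Or.inl rfl, rfl⟩
        · exact Or.inl (Or.inr h)
        · exact Or.inr ⟨v, Or.inr hv, rfl⟩
    · intro x w
      rw [Equiv.Perm.mul_apply, mcx_apply _ _ htt, Function.update_apply]
      by_cases hw : w = t
      · subst hw
        simp [h2, ht, al, het.2]
      · simp [h2, hw]

lemma fan {n : ℕ} (k : ℕ) : ∀ (T : Finset (Fin n)) (i : Fin n), i ∉ T → T.card ≤ 2 ^ k →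
    ∃ σ : Equiv.Perm (Fin n → Bool), Rz Finset.univ (2 * k + 1) σ ∧
    ∀ x w, σ x w = if w ∈ T then xor (x w) (x i) else x w := by
  induction k with
  | zero =>
    intro T i hi hT
    obtain ⟨σ, h1, h2⟩ := pairLayer (fun _ => i) T
      (fun a ha b hb _ => Finset.card_le_one.mp (by simpa using hT) a ha b hb) (fun _ _ => hi)
    exact ⟨σ, h1.mono (Finset.subset_univ _) (by omega), h2⟩
  | succ k ih =>
    intro T i hi hT
    obtain ⟨T2, hT2, hc2⟩ := Finset.exists_subset_card_eq (s := T) (n := T.card / 2) (by omega)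
    have hc1 : (T \ T2).card = T.card - T.card / 2 := by
      rw [Finset.card_sdiff_of_subset hT2, hc2]
    set T1 := T \ T2 with hT1
    obtain ⟨σ, h1, h2⟩ := ih T1 i (fun h => hi (Finset.mem_sdiff.mp h).1)
      (by rw [pow_succ] at hT; omega)
    obtain ⟨e, he1, he2⟩ : ∃ e : Fin n → Fin n, (∀ w ∈ T2, e w ∈ T1) ∧ Set.InjOn e T2 := by
      have : Nonempty (Fin n) := ⟨i⟩
      obtain ⟨e, h1, h2⟩ := Set.Finite.exists_injOn_of_encard_le
        (s := (T2 : Set (Fin n))) (t := (T1 : Set (Fin n))) (Finset.finite_toSet _)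
        (by
          rw [Set.encard_coe_eq_coe_finsetCard, Set.encard_coe_eq_coe_finsetCard]
          exact_mod_cast (by omega : T2.card ≤ T1.card))
      exact ⟨e, fun w hw => by simpa using h1 (by simpa using hw), h2⟩
    obtain ⟨ρ, g1, g2⟩ := pairLayer e T2 he2 (fun w hw => (Finset.mem_sdiff.mp (he1 w hw)).2)
    have g1' := g1.mono (Finset.subset_univ _) le_rfl
    refine ⟨ρ * σ * ρ, ((g1'.seq h1).seq g1').mono subset_rfl (by omega), ?_⟩
    intro x w
    have hiT2 : i ∉ T2 := fun h => hi (hT2 h)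
    simp only [Equiv.Perm.mul_apply]
    rw [g2]
    by_cases hw2 : w ∈ T2
    · have hw1 : w ∉ T1 := fun h => (Finset.mem_sdiff.mp h).2 hw2
      have hew := he1 w hw2
      have hew2 : e w ∉ T2 := (Finset.mem_sdiff.mp hew).2
      simp only [hw2, if_true, h2, hw1, if_false, hew, g2, hew2, hiT2, hT2 hw2]
      cases x w <;> cases x (e w) <;> cases x i <;> rfl
    · have : w ∈ T1 ↔ w ∈ T := by simp [hT1, hw2]
      simp [h2, g2, hw2, hiT2, this]

/-- The cycle `a → b → c → a`. -/
def cyc {α : Type*} [DecidableEq α] (a b c : α) : Equiv.Perm α :=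
  Equiv.swap a b * Equiv.swap b c

lemma cyc_conj {α : Type*} [DecidableEq α] (T : Equiv.Perm α) (a b c : α) :
    T⁻¹ * cyc (T a) (T b) (T c) * T = cyc a b c := by
  unfold cyc
  rw [Equiv.swap_apply_apply, Equiv.swap_apply_apply]
  simp [mul_assoc]

lemma even_decomp {n : ℕ} (D : ℕ)
    (hD : ∀ a b c : Fin n → Bool, a ≠ b → a ≠ c → b ≠ c → Rz Finset.univ D (cyc a b c)) (k : ℕ) :
    ∀ h : Equiv.Perm (Fin n → Bool), Equiv.Perm.sign h = 1 → h.support.card ≤ k →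
      Rz Finset.univ (k * D) h := by
  induction k with
  | zero =>
    intro h _ hk
    have : h = 1 := by simpa using hk
    rw [this]
    exact Rz.one' _ _
  | succ k ih =>
    intro h hs hk
    by_cases h1 : h = 1
    · rw [h1]; exact Rz.one' _ _
    obtain ⟨x, hx⟩ : ∃ x, h x ≠ x := by
      by_contra hcon
      push Not at hcon
      exact h1 (Equiv.ext hcon)
    have hxs : x ∈ h.support := Equiv.Perm.mem_support.mpr hx
    have hys : h x ∈ h.support := Equiv.Perm.apply_mem_support.mpr hxs
    obtain ⟨z, hz, hzx, hzy⟩ : ∃ z ∈ h.support, z ≠ x ∧ z ≠ h x := by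
      by_contra hcon
      push Not at hcon
      have : h.support = {x, h x} := by
        ext z
        simp only [Finset.mem_insert, Finset.mem_singleton]
        constructor
        · intro hz
          by_cases hzx : z = x
          · exact Or.inl hzx
          · exact Or.inr (hcon z hz hzx)
        · rintro (rfl | rfl)
          exacts [hxs, hys]
      have h2 : h.support.card = 2 := by rw [this, Finset.card_pair hx.symm]
      have := (Equiv.Perm.card_support_eq_two.mp h2).sign_eq
      rw [hs] at this
      exact absurd this (by decide)
    have hcyc := hD (h x) x z hx hzy.symm hzx.symm
    set τ := cyc (h x) x z with hτ
    have hsτ : Equiv.Perm.sign τ = 1 := by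
      rw [hτ, cyc, Equiv.Perm.sign_mul, Equiv.Perm.sign_swap hx, Equiv.Perm.sign_swap hzx.symm]
      decide
    have hlt : (τ * h).support.card < h.support.card := by
      apply Finset.card_lt_card
      rw [Finset.ssubset_iff_of_subset]
      · refine ⟨x, hxs, ?_⟩
        rw [Equiv.Perm.notMem_support, Equiv.Perm.mul_apply, hτ, cyc, Equiv.Perm.mul_apply,
          Equiv.swap_apply_of_ne_of_ne hx hzy.symm, Equiv.swap_apply_left]
      · intro w hw
        by_contra hw'
        have hne : ∀ v ∈ h.support, w ≠ v := by
          rintro v hv rfl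
          exact hw' hv
        rw [Equiv.Perm.mem_support, Equiv.Perm.mul_apply,
          Equiv.Perm.notMem_support.mp hw', hτ, cyc, Equiv.Perm.mul_apply,
          Equiv.swap_apply_of_ne_of_ne (hne _ hxs) (hne _ hz),
          Equiv.swap_apply_of_ne_of_ne (hne _ hys) (hne _ hxs)] at hw
        exact hw rfl
    have := ih (τ * h) (by rw [Equiv.Perm.sign_mul, hsτ, hs, one_mul]) (by omega)
    have h3 := hcyc.inv.seq this
    rw [inv_mul_cancel_left] at h3
    exact h3.mono subset_rfl (by rw [Nat.succ_mul]; omega)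

lemma canon_cycle {n : ℕ} (S1 S2 : Finset (Fin n)) (t g : Fin n) (htg : t ≠ g)
    (h1 : t ∉ S1) (h2 : g ∉ S1) (h3 : t ∉ S2) (h4 : g ∉ S2)
    (hu : ∀ w, w ≠ t → w ≠ g → w ∈ S1 ∪ S2) :
    mcx (insert g S1) t * mcx (insert t S2) g * mcx (insert g S1) t * mcx (insert t S2) g =
      cyc (fun _ => true) (Function.update (fun _ => true) t false)
        (Function.update (fun _ => true) g false) := by
  have k1 : t ∉ insert g S1 := by simp [htg, h1]
  have k2 : g ∉ insert t S2 := by simp [htg.symm, h4]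
  have alt : ∀ S : Finset (Fin n), al S (fun _ => true) = true := by simp [al]
  set a : Fin n → Bool := fun _ => true with ha
  set b := Function.update a t false with hb
  set c := Function.update a g false with hc
  have hab : a ≠ b := fun h => by simpa [ha, hb] using congrFun h t
  have hac : a ≠ c := fun h => by simpa [ha, hc] using congrFun h g
  have hbc : b ≠ c := fun h => by simpa [ha, hb, hc, htg] using congrFun h t
  have form : ∀ x, (mcx (insert g S1) t * mcx (insert t S2) g * mcx (insert g S1) t *
      mcx (insert t S2) g) x =
      fun w => if w = t then
          xor (xor (x t) (xor (x g) (x t && al S2 x) && al S1 x))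
            (xor (xor (x g) (x t && al S2 x))
              (xor (x t) (xor (x g) (x t && al S2 x) && al S1 x) && al S2 x) && al S1 x)
        else if w = g then
          xor (xor (x g) (x t && al S2 x))
              (xor (x t) (xor (x g) (x t && al S2 x) && al S1 x) && al S2 x)
        else x w := by
    intro x
    funext w
    simp only [Equiv.Perm.mul_apply, mcx_apply _ _ k1, mcx_apply _ _ k2, al_insert,
      al_update _ _ _ _ h1, al_update _ _ _ _ h2, al_update _ _ _ _ h3, al_update _ _ _ _ h4]
    simp only [Function.update_apply, htg, htg.symm, if_true, if_false]
    by_cases hwt : w = t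
    · simp [hwt]
    · by_cases hwg : w = g
      · simp [hwg, htg.symm]
      · simp [hwt, hwg]
  ext1 x
  rw [form]
  by_cases hxa : x = a
  · have : cyc a b c x = b := by
      rw [hxa, cyc, Equiv.Perm.mul_apply, Equiv.swap_apply_of_ne_of_ne hab hac,
        Equiv.swap_apply_left]
    rw [this, hxa, alt, alt]
    funext w
    by_cases hwt : w = t
    · simp [hwt, ha, hb]
    · by_cases hwg : w = g
      · simp [hwg, ha, hb, htg.symm]
      · simp [hwt, hwg, ha, hb]
  by_cases hxb : x = b
  · have : cyc a b c x = c := by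
      rw [hxb, cyc, Equiv.Perm.mul_apply, Equiv.swap_apply_left,
        Equiv.swap_apply_of_ne_of_ne hac.symm hbc.symm]
    rw [this, hxb, hb, al_update _ _ _ _ h1, al_update _ _ _ _ h3, alt, alt]
    funext w
    by_cases hwt : w = t
    · simp [hwt, ha, hc, htg, htg.symm]
    · by_cases hwg : w = g
      · simp [hwg, ha, hc, htg.symm]
      · simp [hwt, hwg, ha, hc]
  by_cases hxc : x = c
  · have : cyc a b c x = a := by
      rw [hxc, cyc, Equiv.Perm.mul_apply, Equiv.swap_apply_right, Equiv.swap_apply_right]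
    rw [this, hxc, hc, al_update _ _ _ _ h2, al_update _ _ _ _ h4, alt, alt]
    funext w
    by_cases hwt : w = t
    · simp [hwt, ha, htg]
    · by_cases hwg : w = g
      · simp [hwg, ha, htg, htg.symm]
      · simp [hwt, hwg, ha]
  have hfix : cyc a b c x = x := by
    rw [cyc, Equiv.Perm.mul_apply, Equiv.swap_apply_of_ne_of_ne hxb hxc,
      Equiv.swap_apply_of_ne_of_ne hxa hxb]
  rw [hfix]
  have hcase : al S1 x = false ∨ al S2 x = false ∨ (x t = false ∧ x g = false) := by
    by_contra hcon
    push Not at hcon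
    obtain ⟨q1, q2, q3⟩ := hcon
    rw [Bool.ne_false_iff, al_iff] at q1 q2
    have hone : ∀ w, w ≠ t → w ≠ g → x w = true := by
      intro w hw1 hw2
      rcases Finset.mem_union.mp (hu w hw1 hw2) with h | h
      exacts [q1 w h, q2 w h]
    cases hxt : x t
    · have hxg : x g = true := by simpa using q3 hxt
      apply hxb
      funext w
      by_cases hwt : w = t
      · simp [hwt, hb, hxt]
      · by_cases hwg : w = g
        · simp [hwg, hb, ha, hxg, htg.symm]
        · simp [hb, ha, hwt, hone w hwt hwg]
    · cases hxg : x g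
      · apply hxc
        funext w
        by_cases hwg : w = g
        · simp [hwg, hc, hxg]
        · by_cases hwt : w = t
          · simp [hwt, hc, ha, hxt, htg]
          · simp [hc, ha, hwg, hone w hwt hwg]
      · apply hxa
        funext w
        by_cases hwg : w = g
        · simp [hwg, ha, hxg]
        · by_cases hwt : w = t
          · simp [hwt, ha, hxt]
          · simp [ha, hone w hwt hwg]
  have bool1 : ∀ u v p q : Bool, (p = false ∨ q = false ∨ (u = false ∧ v = false)) →
      xor (xor u (xor v (u && q) && p))
        (xor (xor v (u && q)) (xor u (xor v (u && q) && p) && q) && p) = u ∧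
      xor (xor v (u && q)) (xor u (xor v (u && q) && p) && q) = v := by decide
  obtain ⟨b1, b2⟩ := bool1 _ _ _ _ hcase
  rw [b1, b2]
  funext w
  by_cases hwt : w = t
  · simp [hwt]
  · by_cases hwg : w = g
    · simp [hwg, htg.symm]
    · simp [hwt, hwg]

end RevCirc
namespace RevCirc

lemma mcx_sqrt_depth {n : ℕ} (hs : 16 ≤ Nat.sqrt n) (S : Finset (Fin n)) (t g : Fin n)
    (h1 : n ≤ 2 * S.card + 2) (htS : t ∉ S) (hgS : g ∉ S) (htg : t ≠ g) :
    Rz Finset.univ (80 * Nat.sqrt n + 50) (mcx S t) := by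
  have hn1 : Nat.sqrt n * Nat.sqrt n ≤ n := Nat.sqrt_le n
  have hn2 : n < (Nat.sqrt n + 1) * (Nat.sqrt n + 1) := Nat.lt_succ_sqrt n
  have hSn : S.card ≤ n := by simpa using Finset.card_le_univ S
  set s := Nat.sqrt n with hsdef
  have hm := Nat.div_add_mod S.card (2 * s + 2)
  have hm' := Nat.mod_lt S.card (show 0 < 2 * s + 2 by omega)
  set m := S.card / (2 * s + 2) with hmdef
  set r := S.card % (2 * s + 2) with hrdef
  have hm3 : 3 ≤ m := by
    rw [hmdef, Nat.le_div_iff_mul_le (by omega)]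
    nlinarith
  have hms : m ≤ s := by
    by_contra hcon
    push Not at hcon
    have : (s + 1) * (2 * s + 2) ≤ m * (2 * s + 2) := Nat.mul_le_mul_right _ hcon
    nlinarith
  refine (mcx_sqrt s m (by omega) hm3 S t g ?_ ?_ htS hgS htg).mono subset_rfl (by omega)
  · nlinarith
  · nlinarith

lemma canon_depth {n : ℕ} (hs : 16 ≤ Nat.sqrt n) (t g : Fin n) (htg : t ≠ g) :
    Rz Finset.univ (320 * Nat.sqrt n + 200)
      (cyc (fun _ => true) (Function.update (fun _ => true) t false)
        (Function.update (fun _ => true) g false)) := by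
  have hn1 : Nat.sqrt n * Nat.sqrt n ≤ n := Nat.sqrt_le n
  have hn : 256 ≤ n := by nlinarith
  set S : Finset (Fin n) := Finset.univ \ {t, g} with hS
  have hSc : S.card = n - 2 := by
    rw [hS, Finset.card_sdiff_of_subset (Finset.subset_univ _), Finset.card_pair htg]
    simp
  obtain ⟨S1, hS1, hc1⟩ := Finset.exists_subset_card_eq (s := S) (n := (n - 2) / 2) (by omega)
  have hc2 : (S \ S1).card = (n - 2) - (n - 2) / 2 := by
    rw [Finset.card_sdiff_of_subset hS1, hc1, hSc]
  have htS : t ∉ S := by simp [hS]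
  have hgS : g ∉ S := by simp [hS]
  have h1 : t ∉ S1 := fun h => htS (hS1 h)
  have h2 : g ∉ S1 := fun h => hgS (hS1 h)
  have h3 : t ∉ S \ S1 := fun h => htS (Finset.mem_sdiff.mp h).1
  have h4 : g ∉ S \ S1 := fun h => hgS (Finset.mem_sdiff.mp h).1
  obtain ⟨d1, hd1⟩ : S1.Nonempty := Finset.card_pos.mp (by omega)
  obtain ⟨d2, hd2⟩ : (S \ S1).Nonempty := Finset.card_pos.mp (by omega)
  have r1 : Rz Finset.univ (80 * Nat.sqrt n + 50) (mcx (insert g S1) t) := by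
    refine mcx_sqrt_depth hs _ t d2 ?_ ?_ ?_ ?_
    · rw [Finset.card_insert_of_notMem h2, hc1]; omega
    · simp [htg, h1]
    · rw [Finset.mem_insert, not_or]
      exact ⟨fun h => h4 (h ▸ hd2), (Finset.mem_sdiff.mp hd2).2⟩
    · exact fun h => h3 (h ▸ hd2)
  have r2 : Rz Finset.univ (80 * Nat.sqrt n + 50) (mcx (insert t (S \ S1)) g) := by
    refine mcx_sqrt_depth hs _ g d1 ?_ ?_ ?_ ?_
    · rw [Finset.card_insert_of_notMem h3, hc2]; omega
    · rw [Finset.mem_insert, not_or]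
      exact ⟨htg.symm, h4⟩
    · rw [Finset.mem_insert, not_or]
      exact ⟨fun h => h1 (h ▸ hd1), fun h => (Finset.mem_sdiff.mp h).2 hd1⟩
    · exact fun h => h2 (h ▸ hd1)
  rw [← canon_cycle S1 (S \ S1) t g htg h1 h2 h3 h4 ?_]
  · exact (((r1.seq r2).seq r1).seq r2).mono subset_rfl (by omega)
  · intro w hwt hwg
    rw [Finset.union_sdiff_of_subset hS1]
    simp [hS, hwt, hwg]

lemma fan_sqrt {n : ℕ} (T : Finset (Fin n)) (i : Fin n) (hi : i ∉ T) :
    ∃ σ : Equiv.Perm (Fin n → Bool), Rz Finset.univ (4 * Nat.sqrt n + 1) σ ∧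
    ∀ x w, σ x w = if w ∈ T then xor (x w) (x i) else x w := by
  have hT : T.card ≤ 2 ^ (2 * Nat.sqrt n) := by
    have h1 : T.card ≤ n := by simpa using Finset.card_le_univ T
    have h2 : n < (Nat.sqrt n + 1) * (Nat.sqrt n + 1) := Nat.lt_succ_sqrt n
    have h3 : Nat.sqrt n + 1 ≤ 2 ^ Nat.sqrt n := Nat.lt_two_pow_self
    have h4 : (Nat.sqrt n + 1) * (Nat.sqrt n + 1) ≤ 2 ^ Nat.sqrt n * 2 ^ Nat.sqrt n :=
      Nat.mul_le_mul h3 h3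
    rw [two_mul, pow_add]
    omega
  obtain ⟨σ, h1, h2⟩ := fan (2 * Nat.sqrt n) T i hi hT
  exact ⟨σ, h1.mono subset_rfl (by omega), h2⟩

lemma cyc_depth {n : ℕ} (hs : 16 ≤ Nat.sqrt n) (a b c : Fin n → Bool) (hab : a ≠ b)
    (hac : a ≠ c) (hbc : b ≠ c) : Rz Finset.univ (336 * Nat.sqrt n + 208) (cyc a b c) := by
  obtain ⟨N, hN, sN⟩ := mask (Finset.univ.filter fun w => a w = true)
  have sN' : ∀ x w, N x w = xor (x w) (a w) := by
    intro x w
    rw [sN]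
    cases h : a w <;> simp [h]
  obtain ⟨i, hi⟩ : ∃ i, N b i = true := by
    by_contra hcon
    push Not at hcon
    apply hab
    funext w
    have := hcon w
    rw [sN'] at this
    revert this
    cases a w <;> cases b w <;> simp
  obtain ⟨F, hF, sF⟩ := fan_sqrt ((Finset.univ.filter fun w => N b w = true).erase i) i
    (Finset.notMem_erase _ _)
  have sF' : ∀ x w, w ≠ i → F x w = xor (x w) (x i && N b w) := by
    intro x w hw
    rw [sF]
    cases h : N b w <;> simp [h, hw]
  have sFi : ∀ x, F x i = x i := by
    intro x
    rw [sF]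
    simp
  have ea : ∀ w, N a w = false := by intro w; rw [sN']; simp
  have fa : ∀ w, F (N a) w = false := by
    intro w
    by_cases hw : w = i
    · rw [hw, sFi, ea]
    · rw [sF' _ _ hw, ea, ea]; rfl
  have fb : ∀ w, F (N b) w = decide (w = i) := by
    intro w
    by_cases hw : w = i
    · rw [hw, sFi, hi]; simp
    · rw [sF' _ _ hw, hi]; simp [hw]
  obtain ⟨j, hji, hj⟩ : ∃ j, j ≠ i ∧ F (N c) j = true := by
    by_contra hcon
    push Not at hcon
    cases hci : F (N c) i
    · apply hac
      apply N.injective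
      apply F.injective
      funext w
      rw [fa]
      by_cases hw : w = i
      · rw [hw, hci]
      · simpa using (hcon w hw)
    · apply hbc
      apply N.injective
      apply F.injective
      funext w
      rw [fb]
      by_cases hw : w = i
      · rw [hw, hci]; simp
      · have := hcon w hw
        simp [hw] at this ⊢
        exact this
  obtain ⟨G, hG, sG⟩ := fan_sqrt ((Finset.univ.filter fun w => F (N c) w = true).erase j) j
    (Finset.notMem_erase _ _)
  obtain ⟨M, hM, sM⟩ := mask (Finset.univ : Finset (Fin n))
  have sM' : ∀ x w, M x w = !x w := by intro x w; simp [sM]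
  have hN' := hN.mono (Finset.subset_univ _) le_rfl
  have hT := ((hM.seq hG).seq hF).seq hN'
  set T := M * G * F * N with hTdef
  have hTa : T a = fun _ => true := by
    funext w
    simp only [hTdef, Equiv.Perm.mul_apply, sM', sG, fa]
    simp
  have hTb : T b = Function.update (fun _ => true) i false := by
    funext w
    simp only [hTdef, Equiv.Perm.mul_apply, sM', sG, fb, Function.update_apply]
    by_cases hw : w = i <;> simp [hw, hji]
  have hTc : T c = Function.update (fun _ => true) j false := by
    funext w
    simp only [hTdef, Equiv.Perm.mul_apply, sM', sG, Function.update_apply, hj]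
    by_cases hw : w = j
    · simp [hw, hj]
    · cases h : F (N c) w <;> simp [hw, h]
  have h0 := canon_depth hs i j hji.symm
  rw [← cyc_conj T a b c, hTa, hTb, hTc]
  exact ((hT.inv.seq h0).seq hT).mono subset_rfl (by omega)

lemma even_depth {n : ℕ} (hs : 16 ≤ Nat.sqrt n) (h : Equiv.Perm (Fin n → Bool))
    (he : Equiv.Perm.sign h = 1) :
    ∃ c : List (Gate n), realizes c h ∧ depth c ≤ 2 ^ n * (336 * Nat.sqrt n + 208) := by
  refine (even_decomp _ (fun a b c => cyc_depth hs a b c) (2 ^ n) h he ?_).circuit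
  refine (Finset.card_le_univ _).trans ?_
  simp

lemma sign_mcx {n : ℕ} (S : Finset (Fin n)) (t b : Fin n) (ht : t ∉ S) (hb : b ∉ S)
    (htb : t ≠ b) : Equiv.Perm.sign (mcx S t) = 1 := by
  have := mcx_comm_formula ∅ S b t htb (by simp) (by simp) hb ht
  rw [Finset.empty_union] at this
  rw [← this]
  simp only [Equiv.Perm.sign_mul]
  rcases Int.units_eq_one_or (Equiv.Perm.sign (mcx (insert b (∅ : Finset (Fin n))) t)) with h | h <;>
  rcases Int.units_eq_one_or (Equiv.Perm.sign (mcx S b)) with h' | h' <;>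
  rw [h, h'] <;> decide

lemma sign_gate {n : ℕ} (hn : 4 ≤ n) (g : Gate n) : Equiv.Perm.sign g.perm = 1 := by
  have hlt : (insert g.target g.controls).card < (Finset.univ : Finset (Fin n)).card := by
    have h1 := Finset.card_insert_le g.target g.controls
    have h2 : g.controls.card ≤ 2 := g.2.1
    rw [Finset.card_univ, Fintype.card_fin]
    omega
  obtain ⟨b, _, hb⟩ := Finset.exists_mem_notMem_of_card_lt_card hlt
  rw [Finset.mem_insert, not_or] at hb
  exact sign_mcx g.controls g.target b g.2.2 hb.2 (Ne.symm hb.1)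

lemma eval_perm {n : ℕ} (hn : 4 ≤ n) (c : List (Gate n)) :
    ∃ σ : Equiv.Perm (Fin n → Bool), Equiv.Perm.sign σ = 1 ∧ ∀ x, evalCircuit c x = σ x := by
  induction c with
  | nil => exact ⟨1, by simp, fun x => rfl⟩
  | cons g c ih =>
    obtain ⟨σ, h1, h2⟩ := ih
    refine ⟨σ * g.perm, by rw [Equiv.Perm.sign_mul, h1, sign_gate hn, one_mul], fun x => ?_⟩
    rw [Equiv.Perm.mul_apply, g.perm_apply, ← h2]
    rfl

lemma shannonD_le {n : ℕ} (hs : 16 ≤ Nat.sqrt n) :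
    ShannonD n 0 ≤ 2 ^ n * (336 * Nat.sqrt n + 208) := by
  have hn1 : Nat.sqrt n * Nat.sqrt n ≤ n := Nat.sqrt_le n
  have hn : 4 ≤ n := by nlinarith
  unfold ShannonD
  apply csSup_le'
  rintro _ ⟨f, ⟨c, π, hc⟩, rfl⟩
  obtain ⟨σ, h1, h2⟩ := eval_perm (n := n + 0) hn c
  obtain ⟨c', h3, h4⟩ := even_depth (n := n + 0) hs σ h1
  refine le_trans (Nat.sInf_le ⟨c', ⟨π, fun x i => ?_⟩, rfl⟩) h4
  rw [h3, ← h2]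
  exact hc x i

lemma asymp : ∀ᶠ n : ℕ in Filter.atTop,
    (336 * (Nat.sqrt n : ℝ) + 208) ≤ 32 * n / Real.logb 2 n := by
  have h1 := (isLittleO_log_rpow_atTop (show (0 : ℝ) < 1 / 2 by norm_num)).bound
    (show (0 : ℝ) < 1 / 100 by norm_num)
  have h2 := tendsto_natCast_atTop_atTop (R := ℝ) |>.eventually h1
  filter_upwards [h2, Filter.eventually_ge_atTop 2] with n hn hn2
  have hn2' : (2 : ℝ) ≤ n := by exact_mod_cast hn2
  have hlog : 0 < Real.log n := Real.log_pos (by linarith)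
  have hl2 : (1 / 2 : ℝ) < Real.log 2 := by have := Real.log_two_gt_d9; linarith
  rw [← Real.sqrt_eq_rpow, Real.norm_of_nonneg hlog.le,
    Real.norm_of_nonneg (Real.sqrt_nonneg _)] at hn
  have hs : (Nat.sqrt n : ℝ) ≤ Real.sqrt n := Real.nat_sqrt_le_real_sqrt
  have hsq : Real.sqrt n * Real.sqrt n = n := Real.mul_self_sqrt (by linarith)
  have hs1 : 1 ≤ Real.sqrt n := Real.one_le_sqrt.mpr (by linarith)
  have hlb : Real.logb 2 n ≤ 1 / 50 * Real.sqrt n := by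
    rw [Real.logb, div_le_iff₀ (by linarith)]
    nlinarith
  have hlb0 : 0 < Real.logb 2 n := Real.logb_pos (by norm_num) (by linarith)
  rw [le_div_iff₀ hlb0]
  calc (336 * (Nat.sqrt n : ℝ) + 208) * Real.logb 2 n
      ≤ (544 * Real.sqrt n) * (1 / 50 * Real.sqrt n) := by
        apply mul_le_mul _ hlb hlb0.le (by positivity)
        linarith
    _ = 544 / 50 * (Real.sqrt n * Real.sqrt n) := by ring
    _ ≤ 32 * n := by rw [hsq]; linarith

end RevCirc

/-- Theorem: every even permutation of `ℤ₂ⁿ` is realized by a circuit without additional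
inputs of depth at most `(32 + δ)·n·2ⁿ/log₂ n`; in particular
`D(n,0) ≤ (32 + δ)·n·2ⁿ/log₂ n`. -/
theorem shannonD_upper_bound_no_memory :
    ∀ δ : ℝ, 0 < δ → ∃ n₀ : ℕ, ∀ n : ℕ, n > n₀ →
      (∀ h : Equiv.Perm (Fin n → Bool), h ∈ alternatingGroup (Fin n → Bool) →
        ∃ c : List (RevCirc.Gate n), RevCirc.realizes c h ∧
          (RevCirc.depth c : ℝ) ≤ (32 + δ) * n * 2 ^ n / Real.logb 2 n) ∧
      (RevCirc.ShannonD n 0 : ℝ) ≤ (32 + δ) * n * 2 ^ n / Real.logb 2 n := by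
  intro δ hδ
  obtain ⟨n₁, hn₁⟩ := Filter.eventually_atTop.mp RevCirc.asymp
  refine ⟨max n₁ 256, fun n hn => ?_⟩
  have hn1 : n₁ ≤ n := le_trans (le_max_left _ _) hn.le
  have hn2 : 256 ≤ n := le_trans (le_max_right _ _) hn.le
  have hs : 16 ≤ Nat.sqrt n := Nat.le_sqrt.mpr (by omega)
  have hlb0 : 0 < Real.logb 2 n := by
    have : (256 : ℝ) ≤ n := by exact_mod_cast hn2
    exact Real.logb_pos (by norm_num) (by linarith)
  have hbound : ((2 ^ n * (336 * Nat.sqrt n + 208) : ℕ) : ℝ) ≤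
      (32 + δ) * n * 2 ^ n / Real.logb 2 n := by
    have h1 := hn₁ n hn1
    push_cast
    calc (2 : ℝ) ^ n * (336 * (Nat.sqrt n : ℝ) + 208)
        ≤ 2 ^ n * (32 * n / Real.logb 2 n) := by gcongr
      _ = 32 * n * 2 ^ n / Real.logb 2 n := by ring
      _ ≤ (32 + δ) * n * 2 ^ n / Real.logb 2 n := by
        gcongr
        linarith
  constructor
  · intro h hh
    obtain ⟨c, hc1, hc2⟩ := RevCirc.even_depth hs h (Equiv.Perm.mem_alternatingGroup.mp hh)
    exact ⟨c, hc1, le_trans (by exact_mod_cast hc2) hbound⟩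
  · exact le_trans (by exact_mod_cast RevCirc.shannonD_le hs) hbound
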